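/- The family of functions ℝ → ℂ indexed by pairs (a, b) with a ∈ {0, 1} and b ∈ ℕ, where the (a, b)-th function is θ ↦ sin(θ)^a · cos(θ)^b, is linearly independent over ℂ. -/

import Mathlib

open Polynomial in
theorem Polynomial.eq_zero_of_eval_cos_eq_zero (P : ℂ[X])
    (h : ∀ θ : ℝ, Real.sin θ ≠ 0 → P.eval (Real.cos θ : ℂ) = 0) : P = 0 := by
  refine P.eq_zero_of_infinite_isRoot ?_
  refine ((Set.Ioo_infinite (show (-1 : ℝ) < 1 by norm_num)).image
    Complex.ofReal_injective.injOn).mono ?_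
  rintro _ ⟨x, hx, rfl⟩
  have hsin : Real.sin (Real.arccos x) ≠ 0 :=
    (Real.sin_pos_of_pos_of_lt_pi (Real.arccos_pos.2 hx.2) (Real.arccos_lt_pi.2 hx.1)).ne'
  simpa only [Set.mem_ofPred_eq, IsRoot.def, Real.cos_arccos hx.1.le hx.2.le] using h _ hsin

open Polynomial in
theorem Polynomial.eq_zero_of_eval_cos_add_sin_mul_eval_cos_eq_zero (P Q : ℂ[X])
    (h : ∀ θ : ℝ, P.eval (Real.cos θ : ℂ) + Real.sin θ * Q.eval (Real.cos θ : ℂ) = 0) :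
    P = 0 ∧ Q = 0 := by
  have hneg (θ : ℝ) :
      P.eval (Real.cos θ : ℂ) - Real.sin θ * Q.eval (Real.cos θ : ℂ) = 0 := by
    simpa only [Real.cos_neg, Real.sin_neg, Complex.ofReal_neg, neg_mul, ← sub_eq_add_neg]
      using h (-θ)
  refine ⟨P.eq_zero_of_eval_cos_eq_zero fun θ _ => ?_,
    Q.eq_zero_of_eval_cos_eq_zero fun θ hθ => ?_⟩
  · linear_combination (h θ + hneg θ) / 2
  · refine (mul_eq_zero.1 ?_).resolve_left (Complex.ofReal_ne_zero.2 hθ)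
    linear_combination (h θ - hneg θ) / 2


/-- The family of functions `ℝ → ℂ` indexed by pairs `(a, b)` with `a ∈ {0,1}` and `b ∈ ℕ`,
where the `(a,b)`-th function is `θ ↦ sin θ ^ a * cos θ ^ b`, is linearly independent
over `ℂ`. -/
theorem sin_cos_monomials_linearIndependent :
    LinearIndependent ℂ (fun p : Fin 2 × ℕ => fun θ : ℝ =>
      (Real.sin θ : ℂ) ^ (p.1 : ℕ) * (Real.cos θ : ℂ) ^ p.2) := by
  rw [linearIndependent_iff']
  intro s g hg
  let P (a : Fin 2) : Polynomial ℂ :=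
    ∑ p ∈ s, if p.1 = a then Polynomial.monomial p.2 (g p) else 0
  have hP (θ : ℝ) : (P 0).eval (Real.cos θ : ℂ)
      + Real.sin θ * (P 1).eval (Real.cos θ : ℂ) = 0 := by
    rw [← show _ = (0 : ℂ) from congrFun hg θ]
    simp only [P, Polynomial.eval_finsetSum, Finset.mul_sum, ← Finset.sum_add_distrib,
      Finset.sum_apply, Pi.smul_apply, smul_eq_mul]
    refine Finset.sum_congr rfl ?_
    rintro ⟨a, b⟩ -
    fin_cases a
    · simp
    · simp [mul_left_comm]
  have hcoeff : ∀ p ∈ s, (P p.1).coeff p.2 = g p := by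
    intro p hp
    rw [Polynomial.finsetSum_coeff, Finset.sum_eq_single_of_mem p hp]
    · simp
    · intro q _ hqp
      split_ifs with hfst
      · exact Polynomial.coeff_monomial_of_ne _ fun hsnd => hqp (Prod.ext hfst hsnd.symm)
      · exact Polynomial.coeff_zero _
  obtain ⟨h₀, h₁⟩ :=
    Polynomial.eq_zero_of_eval_cos_add_sin_mul_eval_cos_eq_zero _ _ hP
  have hzero : ∀ a, P a = 0 := Fin.forall_fin_two.2 ⟨h₀, h₁⟩
  intro p hp
  rw [← hcoeff p hp, hzero, Polynomial.coeff_zero]
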